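/- (Validity of the Herbrand sequent of the NiA-schema) Let n ∈ ℕ and let f : ℕ → ℕ. If for every i with 0 ≤ i ≤ n+1 there exists j with 0 ≤ j ≤ n and f(m(i)) = j, then there exist i ≤ n and j ≤ i such that m(j) < m(i+1) and f(m(j)) = f(m(i+1)). -/

import Mathlib

/-- Numeric interpretation of the iterated max terms:
`m 0 = 0`, `m (k+1) = max (m k + 1) (m k)`. -/
def mnum : ℕ → ℕ
  | 0 => 0
  | k + 1 => max (mnum k + 1) (mnum k)

theorem mnum_eq (k : ℕ) : mnum k = k := by
  induction k with
  | zero => rfl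
  | succ k ih => simp [mnum, ih]

/-- Validity of the Herbrand sequent of the NiA-schema. -/
theorem stmt14 (n : ℕ) (f : ℕ → ℕ)
    (h : ∀ i ≤ n + 1, ∃ j ≤ n, f (mnum i) = j) :
    ∃ i ≤ n, ∃ j ≤ i, mnum j < mnum (i + 1) ∧ f (mnum j) = f (mnum (i + 1)) := by
  simp only [mnum_eq] at h ⊢
  have hmaps : ∀ i ∈ Finset.range (n + 2), f i ∈ Finset.range (n + 1) := by
    intro i hi
    obtain ⟨j, hj, hij⟩ := h i (by rw [Finset.mem_range] at hi; omega)
    simp only [Finset.mem_range]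
    omega
  obtain ⟨a, ha, b, hb, hab, hf⟩ :=
    Finset.exists_ne_map_eq_of_card_lt_of_maps_to (by simp) hmaps
  simp only [Finset.mem_range] at ha hb
  wlog hlt : a < b generalizing a b
  · exact this b a hab.symm hf.symm hb ha (by omega)
  obtain ⟨i, rfl⟩ : ∃ i, b = i + 1 := ⟨b - 1, by omega⟩
  exact ⟨i, by omega, a, by omega, hlt, hf⟩
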